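/- Let Ψ(x) := cos|x|/(4π|x|) and Λ(x) := 1/(4π|x|) on ℝ³∖{0}. For every f ∈ L^{6/5}(ℝ³) the convolution ((Ψ−Λ)*f)(x) := ∫_{ℝ³}(Ψ−Λ)(x−y)f(y) dy converges absolutely for almost every x, and for every r > 0 the linear operator from L^{6/5}(ℝ³) to L^6(ℝ³) given by f ↦ 1_{B_r}·((Ψ−Λ)*f) is well defined, bounded, and compact (it maps bounded sets to relatively compact sets). -/

import Mathlib

open MeasureTheory Real Metric
open scoped ENNReal

noncomputable section

abbrev E3 := EuclideanSpace ℝ (Fin 3)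

/-- The real part of the outgoing fundamental solution of the Helmholtz operator `-Δ - 1`
on `ℝ³`. -/
def Psi3 (x : E3) : ℝ :=
  Real.cos ‖x‖ / (4 * Real.pi * ‖x‖)

/-- The fundamental solution of `-Δ` on `ℝ³`. -/
def Lambda3 (x : E3) : ℝ :=
  1 / (4 * Real.pi * ‖x‖)

instance : Fact ((1 : ℝ≥0∞) ≤ 6/5) :=
  ⟨by rw [ENNReal.le_div_iff_mul_le (by norm_num) (by norm_num)]; norm_num⟩

instance : Fact ((1 : ℝ≥0∞) ≤ 6) := ⟨by norm_num⟩

open scoped BoundedContinuousFunction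

section CompactFamily

variable {X E : Type*} [TopologicalSpace X] [CompactSpace X]
  [NormedAddCommGroup E] [NormedSpace ℝ E]

/-- A continuous family `k` of functionals on `E`, regarded as the linear map sending `f` to the
function `x ↦ k x f`. -/
def evalFamily (k : C(X, StrongDual ℝ E)) : E →ₗ[ℝ] (X →ᵇ ℝ) where
  toFun f := BoundedContinuousFunction.mkOfCompact
    ⟨fun x => k x f, k.continuous.clm_apply continuous_const⟩
  map_add' f g := by ext x; simp
  map_smul' c f := by ext x; simp

@[simp]
lemma evalFamily_apply (k : C(X, StrongDual ℝ E)) (f : E) (x : X) : evalFamily k f x = k x f :=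
  rfl

lemma isCompactOperator_evalFamily (k : C(X, StrongDual ℝ E)) :
    IsCompactOperator (evalFamily k) := by
  refine ⟨closure (evalFamily k '' ball 0 1), ?_, ?_⟩
  · refine BoundedContinuousFunction.arzela_ascoli (closedBall 0 ‖k‖)
      (isCompact_closedBall _ _) _ ?_ ?_
    · rintro _ x ⟨f, hf, rfl⟩
      rw [mem_ball_zero_iff] at hf
      rw [mem_closedBall_zero_iff, evalFamily_apply]
      calc ‖k x f‖ ≤ ‖k x‖ * ‖f‖ := (k x).le_opNorm f
        _ ≤ ‖k‖ * 1 := by gcongr; exact k.norm_coe_le_norm x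
        _ = ‖k‖ := mul_one _
    · intro x₀
      rw [Metric.equicontinuousAt_iff_right]
      intro ε hε
      have hk := Metric.continuousAt_iff'.1 (k.continuous.continuousAt (x := x₀)) ε hε
      filter_upwards [hk] with x hx
      rintro ⟨_, f, hf, rfl⟩
      rw [mem_ball_zero_iff] at hf
      rw [dist_eq_norm] at hx
      rw [dist_comm, dist_eq_norm]
      calc ‖k x f - k x₀ f‖ = ‖(k x - k x₀) f‖ := by simp
        _ ≤ ‖k x - k x₀‖ * ‖f‖ := (k x - k x₀).le_opNorm f
        _ ≤ ‖k x - k x₀‖ * 1 := by gcongr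
        _ < ε := by rwa [mul_one]
  · filter_upwards [ball_mem_nhds (0 : E) one_pos] with f hf
    exact subset_closure ⟨f, hf, rfl⟩

end CompactFamily

section ExtendByZero

variable {α : Type*} [TopologicalSpace α] {s t : Set α}

lemma norm_extend_zero_le (g : s →ᵇ ℝ) (x : α) :
    ‖Function.extend Subtype.val g 0 x‖ ≤ ‖g‖ := by
  by_cases hx : ∃ a : s, a.1 = x
  · obtain ⟨a, rfl⟩ := hx
    rw [Subtype.val_injective.extend_apply]
    exact g.norm_coe_le_norm a
  · rw [Function.extend_apply' _ _ _ hx]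
    simp

variable [MeasurableSpace α] {μ : Measure α}

lemma eLpNorm_indicator_extend_zero_le (ht : MeasurableSet t) (p : ℝ≥0∞) (g : s →ᵇ ℝ) :
    eLpNorm (t.indicator (Function.extend Subtype.val g 0)) p μ ≤
      μ t ^ p.toReal⁻¹ * ENNReal.ofReal ‖g‖ := by
  rw [eLpNorm_indicator_eq_eLpNorm_restrict ht]
  simpa using eLpNorm_le_of_ae_bound (p := p) (μ := μ.restrict t)
    (Filter.Eventually.of_forall (norm_extend_zero_le g))

variable [BorelSpace α]

lemma aestronglyMeasurable_extend_zero (hs : MeasurableSet s) (g : s →ᵇ ℝ) (ν : Measure α) :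
    AEStronglyMeasurable (Function.extend Subtype.val g 0) ν :=
  ((MeasurableEmbedding.subtype_coe hs).measurable_extend g.continuous.measurable
    measurable_zero).aestronglyMeasurable

lemma memLp_indicator_extend_zero (hs : MeasurableSet s) (ht : MeasurableSet t) (hμ : μ t ≠ ∞)
    (p : ℝ≥0∞) (g : s →ᵇ ℝ) :
    MemLp (t.indicator (Function.extend Subtype.val g 0)) p μ :=
  ⟨(aestronglyMeasurable_extend_zero hs g μ).indicator ht,
    (eLpNorm_indicator_extend_zero_le ht p g).trans_lt
      (ENNReal.mul_lt_top (ENNReal.rpow_lt_top_of_nonneg (by positivity) hμ)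
        ENNReal.ofReal_lt_top)⟩

/-- Extension by zero of a bounded continuous function on `s`, cut off to `t`, as an element
of `L^p`. -/
def extendZeroLp (hs : MeasurableSet s) (ht : MeasurableSet t) (hμ : μ t ≠ ∞) (p : ℝ≥0∞)
    [Fact (1 ≤ p)] : (s →ᵇ ℝ) →L[ℝ] Lp ℝ p μ :=
  LinearMap.mkContinuous
    { toFun := fun g => (memLp_indicator_extend_zero hs ht hμ p g).toLp _
      map_add' := fun f g => by
        rw [← MemLp.toLp_add]
        congr 1
        rw [← Set.indicator_add']
        congr 1
        rw [BoundedContinuousFunction.coe_add, ← Function.extend_add, add_zero]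
      map_smul' := fun c g => by
        rw [RingHom.id_apply, ← MemLp.toLp_const_smul]
        congr 1
        refine Eq.trans ?_ (Set.indicator_const_smul t c _)
        congr 1
        rw [BoundedContinuousFunction.coe_smul]
        conv_lhs => rw [← smul_zero c]
        exact Function.extend_smul c _ _ _ }
    (μ t ^ p.toReal⁻¹).toReal
    fun g => by
      simp only [LinearMap.coe_mk, AddHom.coe_mk]
      rw [Lp.norm_toLp]
      refine (ENNReal.toReal_mono ?_ (eLpNorm_indicator_extend_zero_le ht p g)).trans_eq ?_
      · exact (ENNReal.mul_lt_top (ENNReal.rpow_lt_top_of_nonneg (by positivity) hμ)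
          ENNReal.ofReal_lt_top).ne
      · rw [ENNReal.toReal_mul, ENNReal.toReal_ofReal (norm_nonneg _)]

lemma extendZeroLp_ae_eq (hs : MeasurableSet s) (ht : MeasurableSet t) (hμ : μ t ≠ ∞) (p : ℝ≥0∞)
    [Fact (1 ≤ p)] (g : s →ᵇ ℝ) :
    extendZeroLp hs ht hμ p g =ᵐ[μ] t.indicator (Function.extend Subtype.val g 0) :=
  (memLp_indicator_extend_zero hs ht hμ p g).coeFn_toLp

end ExtendByZero

section Kernel

/-- The difference of the Helmholtz and Laplace kernels. -/
def kernelDiff (x : E3) : ℝ :=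
  Psi3 x - Lambda3 x

lemma kernelDiff_neg (x : E3) : kernelDiff (-x) = kernelDiff x := by
  simp [kernelDiff, Psi3, Lambda3]

lemma measurable_kernelDiff : Measurable kernelDiff := by
  unfold kernelDiff Psi3 Lambda3
  fun_prop

lemma abs_cos_sub_one_mul_le {t : ℝ} (ht : 0 ≤ t) : (1 + t) * |Real.cos t - 1| ≤ 3 * t := by
  have h₁ : |Real.cos t - 1| ≤ t := by
    simpa [abs_of_nonneg ht] using Real.abs_cos_sub_cos_le t 0
  have h₂ : |Real.cos t - 1| ≤ 2 := by
    rw [abs_le]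
    constructor <;> linarith [Real.neg_one_le_cos t, Real.cos_le_one t]
  nlinarith

lemma norm_kernelDiff_le (x : E3) : ‖kernelDiff x‖ ≤ (1 + ‖x‖)⁻¹ := by
  have hK : kernelDiff x = (Real.cos ‖x‖ - 1) / (4 * Real.pi * ‖x‖) := by
    simp only [kernelDiff, Psi3, Lambda3, sub_div]
  rcases (norm_nonneg x).eq_or_lt with h | h
  · rw [hK, ← h]
    simp
  · have hden : 0 < 4 * Real.pi * ‖x‖ := by positivity
    rw [hK, Real.norm_eq_abs, abs_div, abs_of_pos hden, inv_eq_one_div,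
      div_le_div_iff₀ hden (by positivity)]
    nlinarith [abs_cos_sub_one_mul_le h.le, Real.pi_gt_three]

lemma memLp_kernelDiff : MemLp kernelDiff 6 (volume : Measure E3) := by
  have hbase : MemLp (fun x : E3 => (1 + ‖x‖)⁻¹) 6 volume := by
    rw [← integrable_norm_rpow_iff (by fun_prop) (by norm_num) (by norm_num)]
    have h := integrable_one_add_norm (E := E3) (μ := volume) (r := 6)
      (by rw [finrank_euclideanSpace_fin]; norm_num)
    refine h.congr (Filter.Eventually.of_forall fun x => ?_)
    have hx : (0 : ℝ) ≤ 1 + ‖x‖ := by positivity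
    simp only [ENNReal.toReal_ofNat]
    rw [Real.norm_of_nonneg (inv_nonneg.2 hx), Real.inv_rpow hx, Real.rpow_neg hx]
  exact hbase.mono' measurable_kernelDiff.aestronglyMeasurable
    (Filter.Eventually.of_forall norm_kernelDiff_le)

instance : Fact ((6 : ℝ≥0∞) ≠ ∞) := ⟨by norm_num⟩

instance : ENNReal.HolderConjugate 6 (6 / 5) where
  inv_add_inv_eq_inv := by
    rw [ENNReal.inv_div (by norm_num) (by norm_num), inv_one, ← one_div, ENNReal.div_add_div_same]
    norm_num
    exact ENNReal.div_self (by norm_num) (by norm_num)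

/-- The reflected translate `y ↦ kernelDiff (x - y)` as an element of `L^6`. -/
def translateKernel (x : E3) : Lp ℝ (6 : ℝ≥0∞) (volume : Measure E3) :=
  DomAddAct.mk (-x) +ᵥ memLp_kernelDiff.toLp kernelDiff

lemma continuous_translateKernel : Continuous translateKernel :=
  (DomAddAct.continuous_mk.comp continuous_neg).vadd continuous_const

lemma translateKernel_ae_eq (x : E3) :
    translateKernel x =ᵐ[volume] fun y => kernelDiff (x - y) := by
  rw [translateKernel, DomAddAct.mk_vadd_toLp]
  refine (MemLp.coeFn_toLp _).trans (Filter.Eventually.of_forall fun y => ?_)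
  simp only [vadd_eq_add]
  rw [← kernelDiff_neg, neg_add, neg_neg, sub_eq_add_neg]

/-- Convolution with the kernel, evaluated at `x`, as a functional on `L^{6/5}`. -/
def convolutionFunctional (x : E3) :
    StrongDual ℝ (Lp ℝ (6 / 5 : ℝ≥0∞) (volume : Measure E3)) :=
  (ContinuousLinearMap.mul ℝ ℝ).lpPairing volume 6 (6 / 5) (translateKernel x)

lemma continuous_convolutionFunctional : Continuous convolutionFunctional :=
  (ContinuousLinearMap.continuous _).comp continuous_translateKernel

lemma convolutionFunctional_apply (x : E3) (f : Lp ℝ (6 / 5 : ℝ≥0∞) (volume : Measure E3)) :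
    convolutionFunctional x f = ∫ y, (Psi3 (x - y) - Lambda3 (x - y)) * (f : E3 → ℝ) y := by
  rw [convolutionFunctional, ContinuousLinearMap.lpPairing_eq_integral]
  refine integral_congr_ae ?_
  filter_upwards [translateKernel_ae_eq x] with y hy
  rw [hy, ContinuousLinearMap.mul_apply', kernelDiff]

lemma integrable_kernelDiff_mul (x : E3) (f : Lp ℝ (6 / 5 : ℝ≥0∞) (volume : Measure E3)) :
    Integrable (fun y => (Psi3 (x - y) - Lambda3 (x - y)) * (f : E3 → ℝ) y) := by
  refine ((Lp.memLp (translateKernel x)).integrable_mul (Lp.memLp f)).congr ?_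
  filter_upwards [translateKernel_ae_eq x] with y hy
  rw [Pi.mul_apply, hy, kernelDiff]

end Kernel

/-- Proposition 2.3(ii), three-dimensional case: for `f ∈ L^{6/5}(ℝ³)` the convolution
`(Ψ - Λ) * f` converges absolutely a.e., and for every `r > 0` the operator
`f ↦ 1_{B_r}·((Ψ - Λ) * f)` is a well-defined, bounded and compact linear operator from
`L^{6/5}(ℝ³)` to `L^6(ℝ³)`. -/
theorem stmt7 :
    (∀ f : Lp ℝ (6/5 : ℝ≥0∞) (volume : Measure E3),
      ∀ᵐ x : E3, Integrable (fun y => (Psi3 (x - y) - Lambda3 (x - y)) * (f : E3 → ℝ) y)) ∧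
    (∀ r : ℝ, 0 < r →
      ∃ T : Lp ℝ (6/5 : ℝ≥0∞) (volume : Measure E3) →L[ℝ]
            Lp ℝ (6 : ℝ≥0∞) (volume : Measure E3),
        IsCompactOperator T ∧
        ∀ f, (T f : E3 → ℝ) =ᵐ[volume]
          (ball (0 : E3) r).indicator
            (fun x => ∫ y, (Psi3 (x - y) - Lambda3 (x - y)) * (f : E3 → ℝ) y)) := by
  refine ⟨fun f => Filter.Eventually.of_forall fun x => integrable_kernelDiff_mul x f,
    fun r _ => ?_⟩
  have : CompactSpace (closedBall (0 : E3) r) :=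
    isCompact_iff_compactSpace.1 (isCompact_closedBall 0 r)
  let k : C(closedBall (0 : E3) r, StrongDual ℝ (Lp ℝ (6 / 5 : ℝ≥0∞) (volume : Measure E3))) :=
    ⟨fun x => convolutionFunctional x,
      continuous_convolutionFunctional.comp continuous_subtype_val⟩
  let J := extendZeroLp (measurableSet_closedBall (x := (0 : E3)) (ε := r))
    (measurableSet_ball (x := (0 : E3)) (ε := r)) (μ := volume) measure_ball_lt_top.ne 6
  have hk := isCompactOperator_evalFamily k
  refine ⟨J ∘L ContinuousLinearMap.mkOfIsCompactOperator hk, hk.clm_comp J, fun f => ?_⟩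
  refine (extendZeroLp_ae_eq measurableSet_closedBall measurableSet_ball measure_ball_lt_top.ne 6
    (evalFamily k f)).trans
    (Filter.EventuallyEq.of_eq (Set.indicator_congr fun x hx => ?_))
  have hx' : x ∈ closedBall (0 : E3) r := ball_subset_closedBall hx
  exact (Subtype.val_injective.extend_apply (evalFamily k f) 0 ⟨x, hx'⟩).trans
    (convolutionFunctional_apply x f)


end
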